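/- (Lusin–Privalov theorem on the unit circle.) Let f ∈ L^1 and suppose that either f̂(n) = 0 for all integers n < 0, or f̂(n) = 0 for all integers n > 0. Then f vanishes either almost everywhere on 𝕋 or almost nowhere on 𝕋; that is, either f = 0 μ-almost everywhere, or the set {z ∈ 𝕋 : f(z) = 0} has μ-measure zero. -/

import Mathlib

open MeasureTheory Real Complex
open scoped ENNReal

noncomputable section

instance : Fact (0 < 2 * Real.pi) := ⟨by positivity⟩

/-- The unit circle, parametrized as `ℝ / 2πℤ`. -/
abbrev UnitCircle := AddCircle (2 * Real.pi)

/-- The normalized Haar (arclength divided by `2π`) measure on the circle. -/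
abbrev circleMeasure : Measure UnitCircle := AddCircle.haarAddCircle

section Fourier

open AddCircle Filter Topology Polynomial ComplexConjugate

variable {T : ℝ}

lemma fourier_natCast_eq_pow (n : ℕ) (t : AddCircle T) :
    fourier (n : ℤ) t = fourier 1 t ^ n := by
  induction n with
  | zero => simp
  | succ k ih => rw [pow_succ, ← ih, Nat.cast_succ, fourier_add]

/-- The real part of a trigonometric polynomial is the real part of an analytic polynomial. -/
lemma exists_polynomial_re_eq_of_mem_span_fourier {p : C(AddCircle T, ℂ)}
    (hp : p ∈ Submodule.span ℂ (Set.range (@fourier T))) :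
    ∃ P : ℂ[X], ∀ t, (P.eval (fourier 1 t)).re = (p t).re := by
  induction hp using Submodule.closure_induction with
  | zero => exact ⟨0, fun t => by simp⟩
  | add p q _ _ hp hq =>
    obtain ⟨P, hP⟩ := hp
    obtain ⟨Q, hQ⟩ := hq
    exact ⟨P + Q, fun t => by simp only [eval_add, add_re, hP, hQ, ContinuousMap.add_apply]⟩
  | smul_mem c p hp =>
    obtain ⟨n, rfl⟩ := hp
    obtain ⟨k, rfl | rfl⟩ := n.eq_nat_or_neg
    · exact ⟨monomial k c, fun t => by
        rw [eval_monomial, ← fourier_natCast_eq_pow, ContinuousMap.smul_apply, smul_eq_mul]⟩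
    · refine ⟨monomial k (conj c), fun t => ?_⟩
      rw [eval_monomial, ← fourier_natCast_eq_pow, ContinuousMap.smul_apply, smul_eq_mul,
        fourier_neg, ← conj_re, map_mul, conj_conj]

variable [hT : Fact (0 < T)]

lemma exists_mem_span_fourier_norm_sub_lt (g : C(AddCircle T, ℂ)) {ε : ℝ} (hε : 0 < ε) :
    ∃ p ∈ Submodule.span ℂ (Set.range (@fourier T)), ∀ t, ‖p t - g t‖ < ε := by
  have hg : g ∈ (Submodule.span ℂ (Set.range (@fourier T))).topologicalClosure := by
    rw [span_fourier_closure_eq_top]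
    trivial
  obtain ⟨p, hp, hpg⟩ := Metric.mem_closure_iff.1 hg ε hε
  refine ⟨p, hp, fun t => ?_⟩
  rw [← dist_eq_norm, dist_comm]
  exact (ContinuousMap.dist_apply_le_dist t).trans_lt hpg

/-- The indicator of a closed set is the bounded pointwise limit of trigonometric polynomials. -/
lemma exists_seq_span_fourier_tendsto_indicator {K : Set (AddCircle T)} (hK : IsClosed K) :
    ∃ p : ℕ → C(AddCircle T, ℂ), (∀ n, p n ∈ Submodule.span ℂ (Set.range (@fourier T))) ∧
      (∀ n t, ‖p n t‖ ≤ 2) ∧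
      ∀ t, Tendsto (fun n => p n t) atTop (𝓝 (K.indicator (fun _ => (1 : ℂ)) t)) := by
  have hδ (n : ℕ) : (0 : ℝ) < 1 / ((n : ℝ) + 1) := Nat.one_div_pos_of_nat
  let ψ (n : ℕ) : C(AddCircle T, ℂ) :=
    ⟨fun t => ((thickenedIndicator (hδ n) K t : NNReal) : ℂ), by fun_prop⟩
  choose p hp hpψ using fun n => exists_mem_span_fourier_norm_sub_lt (ψ n) (hδ n)
  have hψ_norm (n t) : ‖ψ n t‖ ≤ 1 := by
    have := thickenedIndicator_le_one (hδ n) K t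
    simpa [ψ] using this
  refine ⟨p, hp, fun n t => ?_, fun t => ?_⟩
  · have h1 : 1 / ((n : ℝ) + 1) ≤ 1 := by
      rw [div_le_one (by positivity)]
      linarith [n.cast_nonneg (α := ℝ)]
    calc ‖p n t‖ = ‖(p n t - ψ n t) + ψ n t‖ := by rw [sub_add_cancel]
      _ ≤ ‖p n t - ψ n t‖ + ‖ψ n t‖ := norm_add_le _ _
      _ ≤ 2 := by linarith [hpψ n t, hψ_norm n t]
  · have hlim := tendsto_pi_nhds.1 (thickenedIndicator_tendsto_indicator_closure hδ
      tendsto_one_div_add_atTop_nhds_zero_nat K) t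
    have hψ : Tendsto (fun n => ψ n t) atTop (𝓝 (K.indicator (fun _ => (1 : ℂ)) t)) := by
      have hcont : Continuous fun x : NNReal => (x : ℂ) := by fun_prop
      have hval : K.indicator (fun _ => (1 : ℂ)) t =
          ((closure K).indicator (fun _ => (1 : NNReal)) t : NNReal) := by
        by_cases ht : t ∈ K <;> simp [ht]
      rw [hval]
      exact (hcont.tendsto _).comp hlim
    have hsub : Tendsto (fun n => p n t - ψ n t) atTop (𝓝 0) :=
      squeeze_zero_norm (fun n => (hpψ n t).le) tendsto_one_div_add_atTop_nhds_zero_nat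
    simpa using hsub.add hψ

lemma integrable_mul_continuous {f : AddCircle T → ℂ} (hf : Integrable f haarAddCircle)
    {g : AddCircle T → ℂ} (hg : Continuous g) :
    Integrable (fun t => f t * g t) haarAddCircle := by
  obtain ⟨C, hC⟩ := isCompact_univ.exists_bound_of_continuousOn hg.continuousOn
  exact hf.mul_bdd hg.aestronglyMeasurable (ae_of_all _ fun t => hC t trivial)

lemma integral_mul_polynomial {f : AddCircle T → ℂ} (hf : Integrable f haarAddCircle)
    (h : ∀ n : ℕ, n ≠ 0 → ∫ t, f t * fourier 1 t ^ n ∂haarAddCircle = 0) (P : ℂ[X]) :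
    ∫ t, f t * P.eval (fourier 1 t) ∂haarAddCircle = (∫ t, f t ∂haarAddCircle) * P.eval 0 := by
  induction P using Polynomial.induction_on' with
  | add P Q hP hQ =>
    simp only [eval_add, mul_add]
    rw [integral_add (integrable_mul_continuous hf (by fun_prop))
      (integrable_mul_continuous hf (by fun_prop)), hP, hQ]
  | monomial n c =>
    simp only [eval_monomial, mul_left_comm _ c]
    rw [integral_const_mul]
    rcases eq_or_ne n 0 with rfl | hn
    · simp
    · simp [-fourier_apply, h n hn, hn]

lemma integral_mul_exp_polynomial {f : AddCircle T → ℂ} (hf : Integrable f haarAddCircle)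
    (h : ∀ n : ℕ, n ≠ 0 → ∫ t, f t * fourier 1 t ^ n ∂haarAddCircle = 0) (P : ℂ[X]) :
    ∫ t, f t * Complex.exp (P.eval (fourier 1 t)) ∂haarAddCircle =
      (∫ t, f t ∂haarAddCircle) * Complex.exp (P.eval 0) := by
  obtain ⟨C, hC⟩ := isCompact_univ.exists_bound_of_continuousOn
    (f := fun t : AddCircle T => P.eval (fourier 1 t)) (by fun_prop)
  let F (k : ℕ) (t : AddCircle T) : ℂ := f t * ((P ^ k).eval (fourier 1 t) / k.factorial)
  have hFint (k : ℕ) : Integrable (F k) haarAddCircle :=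
    integrable_mul_continuous hf (by fun_prop)
  have hexp (z : ℂ) : HasSum (fun k : ℕ => z ^ k / k.factorial) (Complex.exp z) := by
    rw [Complex.exp_eq_exp_ℂ]
    exact NormedSpace.expSeries_div_hasSum_exp z
  have hFnorm (k : ℕ) :
      ∫ t, ‖F k t‖ ∂haarAddCircle ≤ (∫ t, ‖f t‖ ∂haarAddCircle) * (C ^ k / k.factorial) := by
    rw [← integral_mul_const]
    refine integral_mono (hFint k).norm (hf.norm.mul_const _) fun t => ?_
    simp only [F, norm_mul, norm_div, eval_pow, norm_pow, RCLike.norm_natCast]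
    gcongr
    exact hC t trivial
  have hsum : Summable fun k => ∫ t, ‖F k t‖ ∂haarAddCircle :=
    .of_nonneg_of_le (fun k => integral_nonneg fun t => norm_nonneg _) hFnorm
      ((Real.summable_pow_div_factorial C).mul_left _)
  have h1 := hasSum_integral_of_summable_integral_norm hFint hsum
  have h2 : ∀ t, ∑' k, F k t = f t * Complex.exp (P.eval (fourier 1 t)) := fun t => by
    simpa only [F, eval_pow] using ((hexp _).mul_left (f t)).tsum_eq
  have h3 : ∀ k, ∫ t, F k t ∂haarAddCircle =
      (∫ t, f t ∂haarAddCircle) * ((P.eval 0) ^ k / k.factorial) := fun k => by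
    simp only [F, ← mul_div_assoc]
    rw [integral_div, integral_mul_polynomial hf h, eval_pow]
  simp only [h2, h3] at h1
  exact h1.unique ((hexp _).mul_left _)

lemma integral_fourier_one_pow {n : ℕ} (hn : n ≠ 0) :
    ∫ t : AddCircle T, fourier 1 t ^ n ∂haarAddCircle = 0 := by
  simp only [← fourier_natCast_eq_pow]
  exact integral_eq_zero_of_add_right_eq_neg
    (fourier_add_half_inv_index (Int.natCast_ne_zero.2 hn) hT.elim)

lemma integral_re_polynomial (P : ℂ[X]) :
    ∫ t : AddCircle T, (P.eval (fourier 1 t)).re ∂haarAddCircle = (P.eval 0).re := by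
  have h := integral_mul_polynomial (T := T) (integrable_const (1 : ℂ))
    (fun n hn => by simpa only [one_mul] using integral_fourier_one_pow hn) P
  have hint : Integrable (fun t : AddCircle T => P.eval (fourier 1 t)) haarAddCircle := by
    simpa using integrable_mul_continuous (T := T) (integrable_const (1 : ℂ))
      (g := fun t => P.eval (fourier 1 t)) (by fun_prop)
  simp only [one_mul, integral_const, probReal_univ, one_smul] at h
  rw [← h]
  exact integral_re hint

/-- Multiplying by `exp (c * P)`, with `P` analytic and `re P` close to the indicator of `K`,
inflates the mean of `f` by `exp (c * μ K)`, without changing `|f|` much outside `K`. -/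
lemma norm_integral_mul_exp_le {f : AddCircle T → ℂ} (hf : Integrable f haarAddCircle)
    (h : ∀ n : ℕ, n ≠ 0 → ∫ t, f t * fourier 1 t ^ n ∂haarAddCircle = 0)
    {K : Set (AddCircle T)} (hK : IsClosed K) (hfK : ∀ t ∈ K, f t = 0) {c : ℝ} (hc : 0 ≤ c) :
    ‖∫ t, f t ∂haarAddCircle‖ * Real.exp (c * (haarAddCircle (T := T)).real K) ≤
      ∫ t, ‖f t‖ ∂haarAddCircle := by
  obtain ⟨p, hp, hp2, hpK⟩ := exists_seq_span_fourier_tendsto_indicator hK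
  choose P hP using fun n => exists_polynomial_re_eq_of_mem_span_fourier (hp n)
  have hre (t) : Tendsto (fun n => (p n t).re) atTop (𝓝 (K.indicator (fun _ => (1 : ℝ)) t)) := by
    have hval : K.indicator (fun _ => (1 : ℝ)) t = (K.indicator (fun _ => (1 : ℂ)) t).re := by
      by_cases ht : t ∈ K <;> simp [ht]
    rw [hval]
    exact (Complex.continuous_re.tendsto _).comp (hpK t)
  have hmean : Tendsto (fun n => ((P n).eval 0).re) atTop
      (𝓝 ((haarAddCircle (T := T)).real K)) := by
    simp only [← integral_re_polynomial (T := T), hP]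
    rw [← integral_indicator_one hK.measurableSet]
    refine tendsto_integral_of_dominated_convergence (fun _ => 2)
      (fun n => (by fun_prop : Continuous fun t => (p n t).re).aestronglyMeasurable)
      (integrable_const _) (fun n => ae_of_all _ fun t => ?_) (ae_of_all _ hre)
    exact (abs_re_le_norm _).trans (hp2 n t)
  have hnorm : Tendsto (fun n => ∫ t, ‖f t‖ * Real.exp (c * (p n t).re) ∂haarAddCircle) atTop
      (𝓝 (∫ t, ‖f t‖ ∂haarAddCircle)) := by
    refine tendsto_integral_of_dominated_convergence (fun t => ‖f t‖ * Real.exp (c * 2))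
      (fun n => ?_) (hf.norm.mul_const _) (fun n => ae_of_all _ fun t => ?_)
      (ae_of_all _ fun t => ?_)
    · exact hf.norm.aestronglyMeasurable.mul
        (by fun_prop : Continuous fun t => Real.exp (c * (p n t).re)).aestronglyMeasurable
    · rw [norm_mul, norm_norm, Real.norm_of_nonneg (Real.exp_pos _).le]
      gcongr
      exact (re_le_norm _).trans (hp2 n t)
    · by_cases ht : t ∈ K
      · simp [hfK t ht]
      · have := hre t
        rw [Set.indicator_of_notMem ht] at this
        simpa using ((this.const_mul c).rexp).const_mul ‖f t‖
  refine le_of_tendsto_of_tendsto' (((hmean.const_mul c).rexp).const_mul _) hnorm fun n => ?_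
  have key := integral_mul_exp_polynomial hf h (Polynomial.C (c : ℂ) * P n)
  have hre_mul (z : ℂ) :
      ‖Complex.exp ((Polynomial.C (c : ℂ) * P n).eval z)‖ =
        Real.exp (c * ((P n).eval z).re) := by
    rw [Complex.norm_exp, eval_mul, eval_C, re_ofReal_mul]
  rw [← hre_mul, ← norm_mul, ← key]
  refine (norm_integral_le_integral_norm _).trans_eq ?_
  simp only [norm_mul, hre_mul, hP]

lemma integral_eq_zero_of_eqOn_zero {f : AddCircle T → ℂ} (hf : Integrable f haarAddCircle)
    (h : ∀ n : ℕ, n ≠ 0 → ∫ t, f t * fourier 1 t ^ n ∂haarAddCircle = 0)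
    {K : Set (AddCircle T)} (hK : IsClosed K) (hfK : ∀ t ∈ K, f t = 0)
    (hK0 : haarAddCircle K ≠ 0) : ∫ t, f t ∂haarAddCircle = 0 := by
  by_contra hne
  have hm : 0 < (haarAddCircle (T := T)).real K := ENNReal.toReal_pos hK0 (measure_ne_top _ _)
  have hlim : Tendsto (fun c : ℝ => ‖∫ t, f t ∂haarAddCircle‖ *
      Real.exp (c * (haarAddCircle (T := T)).real K)) atTop atTop :=
    (Real.tendsto_exp_atTop.comp (tendsto_id.atTop_mul_const hm)).const_mul_atTop
      (norm_pos_iff.2 hne)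
  obtain ⟨c, hc, hc0⟩ := ((hlim.eventually_gt_atTop (∫ t, ‖f t‖ ∂haarAddCircle)).and
    (eventually_ge_atTop 0)).exists
  exact hc.not_ge (norm_integral_mul_exp_le hf h hK hfK hc0)

lemma fourierCoeff_eq_zero_of_eqOn_zero {f : AddCircle T → ℂ} (hf : Integrable f haarAddCircle)
    (h : ∀ n : ℤ, n < 0 → fourierCoeff f n = 0) {K : Set (AddCircle T)} (hK : IsClosed K)
    (hfK : ∀ t ∈ K, f t = 0) (hK0 : haarAddCircle K ≠ 0) (n : ℤ) : fourierCoeff f n = 0 := by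
  have hstep (n : ℤ) (hn : ∀ m < n, fourierCoeff f m = 0) : fourierCoeff f n = 0 := by
    refine integral_eq_zero_of_eqOn_zero (hf.fourier_smul _) (fun k hk => ?_) hK
      (fun t ht => by rw [hfK t ht, smul_zero]) hK0
    rw [← hn (n - k) (by omega), fourierCoeff]
    congr 1 with t
    rw [← fourier_natCast_eq_pow, neg_sub, sub_eq_add_neg, fourier_add, smul_eq_mul, smul_eq_mul]
    ring
  have hnat (n : ℕ) : ∀ m < (n : ℤ), fourierCoeff f m = 0 := by
    induction n with
    | zero => simpa using h
    | succ k ih =>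
      intro m hm
      rcases lt_or_eq_of_le (show m ≤ k by omega) with hlt | rfl
      · exact ih m hlt
      · exact hstep _ ih
  exact hnat (n.toNat + 1) n (by omega)

/-- An integrable function is determined by its Fourier coefficients. -/
lemma ae_eq_zero_of_fourierCoeff_eq_zero {f : AddCircle T → ℂ} (hf : Integrable f haarAddCircle)
    (h : ∀ n : ℤ, fourierCoeff f n = 0) : f =ᵐ[haarAddCircle] 0 := by
  have hspan (p : C(AddCircle T, ℂ)) (hp : p ∈ Submodule.span ℂ (Set.range (@fourier T))) :
      ∫ t, f t * p t ∂haarAddCircle = 0 := by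
    induction hp using Submodule.span_induction with
    | mem p hp =>
      obtain ⟨n, rfl⟩ := hp
      simpa only [fourierCoeff, neg_neg, smul_eq_mul, mul_comm] using h (-n)
    | zero => simp
    | add p q _ _ hp hq =>
      simp only [ContinuousMap.add_apply, mul_add]
      rw [integral_add (integrable_mul_continuous hf p.continuous)
        (integrable_mul_continuous hf q.continuous), hp, hq, add_zero]
    | smul c p _ hp =>
      simp only [ContinuousMap.smul_apply, smul_eq_mul, mul_left_comm _ c]
      rw [integral_const_mul, hp, mul_zero]
  refine ae_eq_zero_of_forall_setIntegral_isClosed_eq_zero hf fun K hK => ?_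
  obtain ⟨p, hp, hp2, hpK⟩ := exists_seq_span_fourier_tendsto_indicator hK
  have hlim : Tendsto (fun n => ∫ t, f t * p n t ∂haarAddCircle) atTop
      (𝓝 (∫ t, f t * K.indicator (fun _ => (1 : ℂ)) t ∂haarAddCircle)) := by
    refine tendsto_integral_of_dominated_convergence (fun t => ‖f t‖ * 2)
      (fun n => (integrable_mul_continuous hf (p n).continuous).aestronglyMeasurable)
      (hf.norm.mul_const _) (fun n => ae_of_all _ fun t => ?_)
      (ae_of_all _ fun t => (hpK t).const_mul _)
    rw [norm_mul]
    gcongr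
    exact hp2 n t
  simp only [hspan _ (hp _)] at hlim
  rw [← integral_indicator hK.measurableSet, ← tendsto_nhds_unique hlim tendsto_const_nhds]
  congr 1 with t
  by_cases ht : t ∈ K <;> simp [ht]

lemma fourierCoeff_conj (f : AddCircle T → ℂ) (n : ℤ) :
    fourierCoeff (fun t => conj (f t)) n = conj (fourierCoeff f (-n)) := by
  rw [fourierCoeff, fourierCoeff, ← integral_conj]
  congr 1 with t
  rw [fourier_neg, neg_neg, smul_eq_mul, smul_eq_mul, map_mul]

lemma ae_eq_zero_or_measure_eq_zero_of_fourierCoeff_neg {f : AddCircle T → ℂ}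
    (hf : Integrable f haarAddCircle) (h : ∀ n : ℤ, n < 0 → fourierCoeff f n = 0) :
    f =ᵐ[haarAddCircle] 0 ∨ haarAddCircle {t | f t = 0} = 0 := by
  refine or_iff_not_imp_right.2 fun hne => ae_eq_zero_of_fourierCoeff_eq_zero hf ?_
  obtain ⟨s, hs, hsm, hs_ae⟩ := (hf.aestronglyMeasurable.nullMeasurableSet_eq_fun
    aestronglyMeasurable_const).exists_measurable_subset_ae_eq
  rw [← measure_congr hs_ae, ← ne_eq, ← pos_iff_ne_zero] at hne
  obtain ⟨K, hKs, hK, hK0⟩ := hsm.exists_lt_isCompact hne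
  exact fourierCoeff_eq_zero_of_eqOn_zero hf h hK.isClosed (fun t ht => hs (hKs ht)) hK0.ne'

end Fourier

/-- **The Lusin–Privalov theorem on the unit circle.** If `f ∈ L¹` and either all negative or
all positive Fourier coefficients of `f` vanish, then `f` vanishes either almost everywhere or
almost nowhere on the circle. -/
theorem statement3
    (f : UnitCircle → ℂ) (hf : Integrable f circleMeasure)
    (h : (∀ n : ℤ, n < 0 → fourierCoeff f n = 0) ∨ (∀ n : ℤ, 0 < n → fourierCoeff f n = 0)) :
    f =ᵐ[circleMeasure] 0 ∨ circleMeasure {z : UnitCircle | f z = 0} = 0 := by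
  rcases h with h | h
  · exact ae_eq_zero_or_measure_eq_zero_of_fourierCoeff_neg hf h
  · have hconj := ae_eq_zero_or_measure_eq_zero_of_fourierCoeff_neg
      (f := fun t => starRingEnd ℂ (f t))
      (Complex.conjCLE.toContinuousLinearMap.integrable_comp hf) fun n hn => by
        rw [fourierCoeff_conj, h (-n) (by omega), map_zero]
    simpa [Filter.EventuallyEq] using hconj
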